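/- In a regular category, a morphism e satisfies the other pullback lemma if and only if e is a regular epimorphism. -/

import Mathlib

open CategoryTheory

/-- A morphism `e` is *extremal* if it factors through no proper subobject:
whenever `e = f ≫ m` with `m` a monomorphism, `m` is an isomorphism. -/
def IsExtremalMor {𝒞 : Type*} [Category 𝒞] {X Y : 𝒞} (e : X ⟶ Y) : Prop :=
  ∀ {A : 𝒞} (f : X ⟶ A) (m : A ⟶ Y), Mono m → f ≫ m = e → IsIso m

/-- The *other pullback lemma* holds along `e : X ⟶ Y` if for every commutative
two-square diagram with bottom-left edge `e` (top row `A ⟶ B ⟶ C`, bottom row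
`X --e--> Y ⟶ Z`, verticals `A ⟶ X`, `B ⟶ Y`, `C ⟶ Z`), pullback-ness of the
left square and of the outer square implies pullback-ness of the right square. -/
def OtherPullbackLemma {𝒞 : Type*} [Category 𝒞] {X Y : 𝒞} (e : X ⟶ Y) : Prop :=
  ∀ {A B C Z : 𝒞} (t₁ : A ⟶ B) (t₂ : B ⟶ C) (f : Y ⟶ Z)
    (vA : A ⟶ X) (vB : B ⟶ Y) (vC : C ⟶ Z),
    t₂ ≫ vC = vB ≫ f →
    IsPullback t₁ vA vB e →
    IsPullback (t₁ ≫ t₂) vA vC (e ≫ f) →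
    IsPullback t₂ vB vC f

/-- A *regular category*: finitely complete, every morphism factors as an
extremal morphism followed by a monomorphism, and extremal morphisms are stable
under pullback. -/
structure RegularCat (𝒞 : Type*) [Category 𝒞] : Prop where
  hasFiniteLimits : Limits.HasFiniteLimits 𝒞
  factor : ∀ {X Y : 𝒞} (f : X ⟶ Y), ∃ (I : 𝒞) (q : X ⟶ I) (m : I ⟶ Y),
    IsExtremalMor q ∧ Mono m ∧ q ≫ m = f
  extremal_stable : ∀ {P X Y Z : 𝒞} (q : X ⟶ Y) (f : Z ⟶ Y) (p₁ : P ⟶ X)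
    (p₂ : P ⟶ Z), IsExtremalMor q → IsPullback p₁ p₂ q f → IsExtremalMor p₂


lemma aux_extremal_epi {𝒞 : Type*} [Category 𝒞]
    (hreg : RegularCat 𝒞) {X Y : 𝒞} {e : X ⟶ Y} (he : IsExtremalMor e) : Epi e := by
  have := hreg.hasFiniteLimits
  constructor
  intro Z g h w
  have := he (Limits.equalizer.lift e w) (Limits.equalizer.ι g h) inferInstance (by simp)
  rw [← cancel_epi (Limits.equalizer.ι g h)]
  exact Limits.equalizer.condition g h

lemma aux_extremal_regular {𝒞 : Type*} [Category 𝒞]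
    (hreg : RegularCat 𝒞) {X Y : 𝒞} {e : X ⟶ Y} (he : IsExtremalMor e) :
    Nonempty (RegularEpi e) := by
  have := hreg.hasFiniteLimits
  have := aux_extremal_epi hreg he
  have key : ∀ {W : 𝒞} (h : X ⟶ W),
      Limits.pullback.fst e e ≫ h = Limits.pullback.snd e e ≫ h → ∃ l : Y ⟶ W, e ≫ l = h := by
    intro W h w
    obtain ⟨I, r, m, hr, hm, hrm⟩ := hreg.factor (Limits.prod.lift e h)
    have h1 : r ≫ m ≫ Limits.prod.fst = e := by
      rw [← Category.assoc, hrm]; exact Limits.prod.lift_fst _ _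
    have h2 : r ≫ m ≫ Limits.prod.snd = h := by
      rw [← Category.assoc, hrm]; exact Limits.prod.lift_snd _ _
    have hmono : Mono (m ≫ (Limits.prod.fst : Y ⨯ W ⟶ Y)) := by
      constructor
      intro T a b hab
      let c₁ := Limits.pullback.snd r a
      let c₂ := Limits.pullback.snd r (c₁ ≫ b)
      have : Epi c₁ := aux_extremal_epi hreg
        (hreg.extremal_stable _ _ _ _ hr (IsPullback.of_hasPullback r a))
      have : Epi c₂ := aux_extremal_epi hreg
        (hreg.extremal_stable _ _ _ _ hr (IsPullback.of_hasPullback r (c₁ ≫ b)))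
      let x := c₂ ≫ Limits.pullback.fst r a
      let y := Limits.pullback.fst r (c₁ ≫ b)
      have hx : x ≫ r = c₂ ≫ c₁ ≫ a := by
        simp only [x, c₁, Category.assoc, Limits.pullback.condition]
      have hy : y ≫ r = c₂ ≫ c₁ ≫ b := Limits.pullback.condition
      have hxy : x ≫ e = y ≫ e := by
        rw [← h1, ← Category.assoc, hx, ← Category.assoc y, hy]
        simp only [Category.assoc] at hab ⊢
        rw [hab]
      have hxy2 : x ≫ h = y ≫ h := by
        have := congrArg (fun t => Limits.pullback.lift x y hxy ≫ t) w
        simp only [← Category.assoc] at this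
        rwa [Limits.pullback.lift_fst, Limits.pullback.lift_snd] at this
      rw [← cancel_epi c₁, ← cancel_epi c₂, ← cancel_mono m]
      apply Limits.prod.hom_ext
      · simp only [Category.assoc] at hab ⊢
        rw [hab]
      · rw [← hx, ← hy]
        simpa only [Category.assoc, h2] using hxy2
    have := he r _ hmono h1
    refine ⟨inv (m ≫ (Limits.prod.fst : Y ⨯ W ⟶ Y)) ≫ m ≫ Limits.prod.snd, ?_⟩
    rw [← h2]
    conv_lhs => rw [← h1]
    simp only [Category.assoc]
    have := IsIso.hom_inv_id_assoc (m ≫ (Limits.prod.fst : Y ⨯ W ⟶ Y)) (m ≫ Limits.prod.snd)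
    simp only [Category.assoc] at this
    rw [this]
  refine ⟨{ W := _, left := Limits.pullback.fst e e, right := Limits.pullback.snd e e,
            w := Limits.pullback.condition, isColimit := ?_ }⟩
  exact Limits.Cofork.IsColimit.mk _ (fun s => (key s.π s.condition).choose)
    (fun s => (key s.π s.condition).choose_spec)
    (fun s m hm => by
      rw [← cancel_epi e]
      exact hm.trans (key s.π s.condition).choose_spec.symm)

/-- In a regular category, a morphism `e` satisfies the other pullback lemma if
and only if `e` is a regular epimorphism. -/
theorem otherPullbackLemma_iff_regularEpi {𝒞 : Type*} [Category 𝒞]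
    (hreg : RegularCat 𝒞) {X Y : 𝒞} (e : X ⟶ Y) :
    OtherPullbackLemma e ↔ Nonempty (RegularEpi e) := by
  have := hreg.hasFiniteLimits
  constructor
  · intro H
    apply aux_extremal_regular hreg
    intro I q m hm hqm
    have hl : IsPullback q (𝟙 X) m e :=
      IsPullback.of_isLimit' ⟨by simp [hqm]⟩
        (Limits.PullbackCone.IsLimit.mk _ (fun s => s.snd)
          (fun s => by rw [← cancel_mono m, Category.assoc, hqm, s.condition])
          (fun s => by simp) (fun s t _ h => by simpa using h))
    have ho : IsPullback (q ≫ m) (𝟙 X) (𝟙 Y) (e ≫ 𝟙 Y) := by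
      rw [hqm, Category.comp_id]
      exact IsPullback.of_vert_isIso ⟨by simp⟩
    have := H q m (𝟙 Y) (𝟙 X) m (𝟙 Y) rfl hl ho
    exact this.isIso_fst_of_isIso
  · rintro ⟨hE⟩
    have he : IsExtremalMor e := by
      intro I q m hm hqm
      have : IsRegularEpi e := ⟨⟨hE⟩⟩
      have : StrongEpi (q ≫ m) := by rw [hqm]; infer_instance
      have := strongEpi_of_strongEpi q m
      exact isIso_of_mono_of_strongEpi m
    intro A B C Z t₁ t₂ f vA vB vC w hl ho
    have hP := IsPullback.of_hasPullback vC f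
    let u : B ⟶ Limits.pullback vC f := hP.lift t₂ vB w
    have hu1 : u ≫ Limits.pullback.fst vC f = t₂ := hP.lift_fst _ _ _
    have hu2 : u ≫ Limits.pullback.snd vC f = vB := hP.lift_snd _ _ _
    have hsq : IsPullback (t₁ ≫ u) vA (Limits.pullback.snd vC f) e := by
      refine IsPullback.of_right ?_ ?_ hP
      · rw [Category.assoc, hu1]; exact ho
      · rw [Category.assoc, hu2]; exact hl.w
    have hext : IsExtremalMor (t₁ ≫ u) := hreg.extremal_stable _ _ _ _ he hsq.flip
    have hmono : Mono u := by
      constructor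
      intro T a b hab
      let c := Limits.pullback.snd e (a ≫ vB)
      let x := Limits.pullback.fst e (a ≫ vB)
      have hc : x ≫ e = c ≫ a ≫ vB := Limits.pullback.condition
      have : Epi c := aux_extremal_epi hreg
        (hreg.extremal_stable _ _ _ _ he (IsPullback.of_hasPullback e (a ≫ vB)))
      have hv : a ≫ vB = b ≫ vB := by
        rw [← hu2, ← Category.assoc, hab, Category.assoc]
      have ht : a ≫ t₂ = b ≫ t₂ := by
        rw [← hu1, ← Category.assoc, hab, Category.assoc]
      have ha' : (c ≫ a) ≫ vB = x ≫ e := by rw [hc, Category.assoc]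
      have hb' : (c ≫ b) ≫ vB = x ≫ e := by
        rw [hc, Category.assoc]; exact congrArg (fun t => c ≫ t) hv.symm
      have : hl.lift (c ≫ a) x ha' = hl.lift (c ≫ b) x hb' := by
        apply ho.hom_ext
        · rw [← Category.assoc, ← Category.assoc, hl.lift_fst, hl.lift_fst,
            Category.assoc, Category.assoc, ht]
        · rw [hl.lift_snd, hl.lift_snd]
      have h3 := congrArg (fun t => t ≫ t₁) this
      simp only [hl.lift_fst] at h3
      exact (cancel_epi c).1 h3
    have := hext t₁ u hmono rfl
    exact IsPullback.of_iso_pullback ⟨w⟩ (asIso u) hu1 hu2
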